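/- arXiv:math/0603661 — 3 statements merged into one kernel-verified Lean document; each statement's English description precedes it below -/
import Mathlib

section
/- Let S be a countable set, H a complex Hilbert space, and let (v(s))_{s∈S} be a family of vectors in H whose linear span is dense in H. Let k(t,s) := ⟨v(t), v(s)⟩ be the Gram matrix, and let c > 0. Then (v(s))_{s∈S} is a tight frame for H with frame constant c if and only if the following two conditions hold: (i) k(t,s) = conj(k(s,t)) for all s,t ∈ S; and (ii) for all s₁, s₂ ∈ S, the family (k(s₁,t)·k(t,s₂))_{t∈S} is summable and Σ_{t∈S} k(s₁,t)·k(t,s₂) = c⁻¹·k(s₁,s₂). -/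
open scoped InnerProductSpace ComplexConjugate

section TightFrame

variable {S H : Type*} [NormedAddCommGroup H] [InnerProductSpace ℂ H] {v : S → H}

/-- Polarization: the frame identity on norms extends to inner products. -/
lemma hasSum_inner_mul_inner_of_norm_sq {c : ℝ}
    (h : ∀ f : H, HasSum (fun s => ‖⟪v s, f⟫_ℂ‖ ^ 2) (c⁻¹ * ‖f‖ ^ 2)) (x y : H) :
    HasSum (fun t => ⟪x, v t⟫_ℂ * ⟪v t, y⟫_ℂ) ((c : ℂ)⁻¹ * ⟪x, y⟫_ℂ) := by
  have h' (f : H) : HasSum (fun s => (‖⟪v s, f⟫_ℂ‖ : ℂ) ^ 2) ((c : ℂ)⁻¹ * (‖f‖ : ℂ) ^ 2) :=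
    mod_cast Complex.hasSum_ofReal.2 (h f)
  convert (((h' (x + y)).sub (h' (x - y))).add
    (((h' (x - Complex.I • y)).sub (h' (x + Complex.I • y))).mul_right Complex.I)).div_const 4
    using 1
  · rfl
  · funext t
    have := inner_eq_sum_norm_sq_div_four (𝕜 := ℂ) ⟪v t, x⟫_ℂ ⟪v t, y⟫_ℂ
    simp only [inner_add_right, inner_sub_right, inner_smul_right]
    simpa [RCLike.inner_apply, mul_comm] using this
  · rw [inner_eq_sum_norm_sq_div_four (𝕜 := ℂ) x y]
    simp only [RCLike.I_to_complex, Complex.coe_algebraMap]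
    ring

/-- If the Gram matrix satisfies the reproducing identity, then so do all vectors in the span. -/
lemma hasSum_inner_mul_inner_of_mem_span {a : ℂ}
    (h : ∀ s₁ s₂, HasSum (fun t => ⟪v s₁, v t⟫_ℂ * ⟪v t, v s₂⟫_ℂ) (a * ⟪v s₁, v s₂⟫_ℂ))
    {x y : H} (hx : x ∈ Submodule.span ℂ (Set.range v))
    (hy : y ∈ Submodule.span ℂ (Set.range v)) :
    HasSum (fun t => ⟪x, v t⟫_ℂ * ⟪v t, y⟫_ℂ) (a * ⟪x, y⟫_ℂ) := by
  induction hx, hy using Submodule.span_induction₂ with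
  | mem_mem x y hx hy =>
    obtain ⟨s, rfl⟩ := hx
    obtain ⟨t, rfl⟩ := hy
    exact h s t
  | zero_left y hy => simp [hasSum_zero]
  | zero_right x hx => simp [hasSum_zero]
  | add_left x y z _ _ _ hx hy => simpa [inner_add_left, add_mul, mul_add] using hx.add hy
  | add_right x y z _ _ _ hx hy => simpa [inner_add_right, mul_add] using hx.add hy
  | smul_left r x y _ _ h =>
    simpa [inner_smul_left, mul_assoc, mul_comm, mul_left_comm] using h.mul_left (conj r)
  | smul_right r x y _ _ h =>
    simpa [inner_smul_right, mul_assoc, mul_left_comm] using h.mul_left r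

/-- The frame identity on a dense set gives the Bessel inequality for finite partial sums. -/
lemma sum_norm_inner_sq_le_of_dense {a : ℝ} {D : Set H} (hD : Dense D)
    (h : ∀ f ∈ D, HasSum (fun s => ‖⟪v s, f⟫_ℂ‖ ^ 2) (a * ‖f‖ ^ 2)) (F : Finset S) (f : H) :
    ∑ s ∈ F, ‖⟪v s, f⟫_ℂ‖ ^ 2 ≤ a * ‖f‖ ^ 2 := by
  have hcl : IsClosed {f : H | ∑ s ∈ F, ‖⟪v s, f⟫_ℂ‖ ^ 2 ≤ a * ‖f‖ ^ 2} :=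
    isClosed_le (by fun_prop) (by fun_prop)
  exact hcl.closure_subset_iff.2
    (fun g hg => sum_le_hasSum F (fun _ _ => by positivity) (h g hg)) (hD f)

/-- The frame identity extends from a dense set to the whole space. -/
lemma hasSum_norm_inner_sq_of_dense {a : ℝ} (ha : 0 ≤ a) {D : Set H} (hD : Dense D)
    (h : ∀ f ∈ D, HasSum (fun s => ‖⟪v s, f⟫_ℂ‖ ^ 2) (a * ‖f‖ ^ 2)) (f : H) :
    HasSum (fun s => ‖⟪v s, f⟫_ℂ‖ ^ 2) (a * ‖f‖ ^ 2) := by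
  have hle := sum_norm_inner_sq_le_of_dense hD h
  have hs (f : H) : Summable fun s => ‖⟪v s, f⟫_ℂ‖ ^ 2 :=
    summable_of_sum_le (fun _ => by positivity) (fun F => hle F f)
  have hmem (f : H) : Memℓp (fun s => ⟪v s, f⟫_ℂ) 2 :=
    memℓp_gen (by simpa using hs f)
  let T : H →ₗ[ℂ] lp (fun _ : S => ℂ) 2 :=
    { toFun f := ⟨fun s => ⟪v s, f⟫_ℂ, hmem f⟩
      map_add' x y := by ext s; exact inner_add_right _ _ _
      map_smul' r x := by ext s; exact inner_smul_right _ _ _ }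
  have hT (f : H) : ‖T f‖ ^ 2 = ∑' s, ‖⟪v s, f⟫_ℂ‖ ^ 2 := by
    simpa [T] using lp.norm_rpow_eq_tsum (p := 2) (by simp) (T f)
  have hbound (f : H) : ‖T f‖ ≤ √a * ‖f‖ := by
    refine abs_le_of_sq_le_sq' ?_ (by positivity) |>.2
    rw [hT, mul_pow, Real.sq_sqrt ha]
    exact (hs f).tsum_le_of_sum_le (fun F => hle F f)
  have hcont : Continuous T := (T.mkContinuous _ hbound).continuous
  have heq : (fun f => ‖T f‖ ^ 2) = fun f => a * ‖f‖ ^ 2 :=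
    Continuous.ext_on hD (by fun_prop) (by fun_prop) fun g hg => by
      simpa [hT] using (h g hg).tsum_eq
  rw [← congrFun heq f, hT]
  exact (hs f).hasSum

end TightFrame

/-- Let `(v s)_{s ∈ S}` be a family with dense linear span in a complex
Hilbert space `H`, let `k (t, s) := ⟨v t, v s⟩` be its Gram matrix, and let `c > 0`.  Then
`(v s)` is a tight frame with frame constant `c` if and only if (i) `k t s = conj (k s t)`
and (ii) for all `s₁ s₂`, the family `(k s₁ t · k t s₂)_t` is summable with
`Σ_t k s₁ t · k t s₂ = c⁻¹ · k s₁ s₂`. -/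
theorem tight_frame_iff_gram_matrix_projection
    (S : Type*) [Countable S]
    (H : Type*) [NormedAddCommGroup H] [InnerProductSpace ℂ H] [CompleteSpace H]
    (v : S → H) (c : ℝ) (hc : 0 < c)
    (hdense : Dense (Submodule.span ℂ (Set.range v) : Set H)) :
    (∀ f : H, ‖f‖ ^ 2 = c * ∑' s : S, ‖⟪v s, f⟫_ℂ‖ ^ 2) ↔
      ((∀ s t : S, ⟪v t, v s⟫_ℂ = conj ⟪v s, v t⟫_ℂ) ∧
        ∀ s₁ s₂ : S,
          Summable (fun t : S => ⟪v s₁, v t⟫_ℂ * ⟪v t, v s₂⟫_ℂ) ∧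
          ∑' t : S, ⟪v s₁, v t⟫_ℂ * ⟪v t, v s₂⟫_ℂ = (c : ℂ)⁻¹ * ⟪v s₁, v s₂⟫_ℂ) := by
  constructor
  · intro h
    refine ⟨fun s t => (inner_conj_symm _ _).symm, fun s₁ s₂ => ?_⟩
    have hsum (f : H) : HasSum (fun s => ‖⟪v s, f⟫_ℂ‖ ^ 2) (c⁻¹ * ‖f‖ ^ 2) := by
      have hs : Summable fun s => ‖⟪v s, f⟫_ℂ‖ ^ 2 := by
        by_contra hns
        have hf := h f
        rw [tsum_eq_zero_of_not_summable hns] at hf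
        obtain rfl : f = 0 := by simpa using hf
        exact hns (by simp)
      rw [h f, inv_mul_cancel_left₀ hc.ne']
      exact hs.hasSum
    have := hasSum_inner_mul_inner_of_norm_sq hsum (v s₁) (v s₂)
    exact ⟨this.summable, this.tsum_eq⟩
  · rintro ⟨-, h⟩ f
    have hspan (g : H) (hg : g ∈ (Submodule.span ℂ (Set.range v) : Set H)) :
        HasSum (fun s => ‖⟪v s, g⟫_ℂ‖ ^ 2) (c⁻¹ * ‖g‖ ^ 2) := by
      have := hasSum_inner_mul_inner_of_mem_span
        (fun s₁ s₂ => (h s₁ s₂).2 ▸ (h s₁ s₂).1.hasSum) hg hg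
      rw [← Complex.hasSum_ofReal]
      convert this using 1
      · funext t
        rw [← inner_conj_symm g, Complex.conj_mul']
        push_cast
        rfl
      · rw [inner_self_eq_norm_sq_to_K]
        push_cast
        rfl
    rw [(hasSum_norm_inner_sq_of_dense (inv_nonneg.2 hc.le) hdense hspan f).tsum_eq,
      mul_inv_cancel_left₀ hc.ne']
end

section
/- Let S be a countable set, H a complex Hilbert space, and let (v(s))_{s∈S} be a frame for H with frame bounds 0 < A₁ ≤ A₂ < ∞, i.e., A₁‖f‖² ≤ Σ_{s∈S} |⟨v(s), f⟩|² ≤ A₂‖f‖² for all f ∈ H. Let V : H → ℓ²(S) be the analysis operator (Vf)(s) = ⟨v(s), f⟩. Then V*V is an invertible bounded operator on H, and there exists a bounded selfadjoint positive operator T on H with T∘T = (V*V)⁻¹ such that the family w(s) := T(v(s)), s ∈ S, is a Parseval frame for H. -/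
open scoped InnerProductSpace ComplexOrder
open ContinuousLinearMap

/-- Let `(v s)_{s ∈ S}` be a frame with bounds `0 < A₁ ≤ A₂ < ∞` for a
complex Hilbert space `H`, with analysis operator `V : H → ℓ²(S)`, `(V f) s = ⟨v s, f⟩`.
Then `V*V` is an invertible bounded operator on `H`, and there is a bounded selfadjoint
positive operator `T` on `H` with `T ∘ T = (V*V)⁻¹` such that `(T (v s))_{s ∈ S}` is a
Parseval frame for `H`. -/
theorem frame_operator_invertible_and_canonical_parseval_frame
    (S : Type*) [Countable S]
    (H : Type*) [NormedAddCommGroup H] [InnerProductSpace ℂ H] [CompleteSpace H]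
    (v : S → H) (A₁ A₂ : ℝ) (hA₁ : 0 < A₁) (hA₁₂ : A₁ ≤ A₂)
    (hframe : ∀ f : H,
      A₁ * ‖f‖ ^ 2 ≤ ∑' s : S, ‖⟪v s, f⟫_ℂ‖ ^ 2 ∧
      ∑' s : S, ‖⟪v s, f⟫_ℂ‖ ^ 2 ≤ A₂ * ‖f‖ ^ 2)
    (V : H →L[ℂ] lp (fun _ : S => ℂ) 2)
    (hV : ∀ (f : H) (s : S), V f s = ⟪v s, f⟫_ℂ) :
    ∃ W : H →L[ℂ] H,
      (adjoint V ∘L V) ∘L W = 1 ∧ W ∘L (adjoint V ∘L V) = 1 ∧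
      ∃ T : H →L[ℂ] H, IsSelfAdjoint T ∧ (∀ f : H, 0 ≤ ⟪f, T f⟫_ℂ) ∧
        T ∘L T = W ∧
        ∀ f : H, ‖f‖ ^ 2 = ∑' s : S, ‖⟪T (v s), f⟫_ℂ‖ ^ 2 := by
  have sum_eq (f : H) : ∑' s : S, ‖⟪v s, f⟫_ℂ‖ ^ 2 = ‖V f‖ ^ 2 := by
    have h := lp.norm_rpow_eq_tsum (p := 2) (by norm_num) (V f)
    simp only [ENNReal.toReal_ofNat, Real.rpow_ofNat, hV] at h
    exact h.symm
  set G : H →L[ℂ] H := adjoint V ∘L V with hG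
  have inner_G (f g : H) : ⟪G f, g⟫_ℂ = ⟪V f, V g⟫_ℂ := by
    simp [hG, adjoint_inner_left]
  have G_pos : 0 ≤ G :=
    (nonneg_iff_isPositive G).2 (isPositive_adjoint_comp_self V)
  have G_unit : IsUnit G := by
    refine isUnit_of_forall_le_norm_inner_map G (c := ⟨A₁, hA₁.le⟩) hA₁ fun f => ?_
    rw [inner_G, inner_self_eq_norm_sq_to_K]
    have h := (hframe f).1
    rw [sum_eq] at h
    rw [mul_comm] at h
    simpa using! h
  obtain ⟨U, hU⟩ := G_unit
  set W : H →L[ℂ] H := ↑U⁻¹ with hW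
  have GW : G * W = 1 := by rw [← hU, hW, U.mul_inv]
  have WG : W * G = 1 := by rw [← hU, hW, U.inv_mul]
  have W_pos : 0 ≤ W := by
    rw [hW]
    exact CFC.inv_nonneg_of_nonneg U (hU ▸ G_pos)
  refine ⟨W, GW, WG, CFC.sqrt W, ?_⟩
  have T_pos : (CFC.sqrt W).IsPositive :=
    (nonneg_iff_isPositive _).1 (CFC.sqrt_nonneg W)
  have TT : CFC.sqrt W * CFC.sqrt W = W := CFC.sqrt_mul_sqrt_self W W_pos
  generalize CFC.sqrt W = T at T_pos TT ⊢
  refine ⟨T_pos.isSelfAdjoint, T_pos.inner_nonneg_right, TT, fun f => ?_⟩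
  have TGT : T * (G * T) = 1 := by
    have TTG : T * (T * G) = 1 := by rw [← mul_assoc, TT, WG]
    have GTT : (G * T) * T = 1 := by rw [mul_assoc, TT, GW]
    rw [left_inv_eq_right_inv GTT TTG, TTG]
  have T_symm (x y : H) : ⟪T x, y⟫_ℂ = ⟪x, T y⟫_ℂ := T_pos.isSymmetric x y
  have key : ⟪V (T f), V (T f)⟫_ℂ = ⟪f, f⟫_ℂ := by
    have h : T (G (T f)) = f := DFunLike.congr_fun TGT f
    rw [← inner_G, ← T_symm, h]
  simp only [T_symm]
  rw [sum_eq, ← inner_self_eq_norm_sq (𝕜 := ℂ), ← inner_self_eq_norm_sq (𝕜 := ℂ), key]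
end

section
/- Let H be a complex Hilbert space and let F₀, F₁ be bounded operators on H satisfying F_i F_j* = δ_{ij}·I for i, j ∈ {0,1}, F₀*F₀ + F₁*F₁ = I, and F₀ⁿf → 0 as n → ∞ for every f ∈ H. Let S be a countable set and (v(s))_{s∈S} a frame for H with frame bounds 0 < A₁ ≤ A₂ < ∞. For k ∈ {0,1,2,…} and s ∈ S define v(k,s) := F₀*^k F₁* (v(s)). Then: (i) ⟨v(j,s), v(k,t)⟩ = δ_{jk}·⟨v(s), v(t)⟩ for all j, k ≥ 0 and s, t ∈ S (so the Gramian of the refined system is I ⊗ G, with G the Gramian of (v(s))); and (ii) the system (v(k,s))_{k≥0, s∈S} is a frame for H with the same frame bounds: A₁‖f‖² ≤ Σ_{k≥0} Σ_{s∈S} |⟨v(k,s), f⟩|² ≤ A₂‖f‖² for all f ∈ H. -/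
open scoped InnerProductSpace
open ContinuousLinearMap

section

variable {H : Type*} [NormedAddCommGroup H] [InnerProductSpace ℂ H]

lemma summable_of_frame_lower_bound {S : Type*} {v : S → H} {A : ℝ} (hA : 0 < A) {f : H}
    (h : A * ‖f‖ ^ 2 ≤ ∑' s : S, ‖⟪v s, f⟫_ℂ‖ ^ 2) :
    Summable fun s : S => ‖⟪v s, f⟫_ℂ‖ ^ 2 := by
  rcases eq_or_ne f 0 with rfl | hf
  · simp
  · by_contra hs
    rw [tsum_eq_zero_of_not_summable hs] at h
    have : 0 < ‖f‖ := norm_pos_iff.mpr hf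
    exact absurd h (not_le.mpr (by positivity))

variable [CompleteSpace H]

lemma inner_adjoint_pow_apply (F₀ F₁ : H →L[ℂ] H) (k : ℕ) (x f : H) :
    ⟪(adjoint F₀ ^ k) (adjoint F₁ x), f⟫_ℂ = ⟪x, F₁ ((F₀ ^ k) f)⟫_ℂ := by
  rw [← star_eq_adjoint F₀, ← star_pow, star_eq_adjoint, adjoint_inner_left, adjoint_inner_left]

lemma pow_apply_adjoint_pow_add {F : H →L[ℂ] H} (h : F ∘L adjoint F = 1) (j m : ℕ) (x : H) :
    (F ^ j) ((adjoint F ^ (j + m)) x) = (adjoint F ^ m) x := by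
  induction j with
  | zero => simp
  | succ j ih =>
    rw [show j + 1 + m = (j + m) + 1 by ring, pow_succ F, pow_succ' (adjoint F)]
    have := DFunLike.congr_fun h ((adjoint F ^ (j + m)) x)
    simp only [comp_apply, one_apply_eq_self] at this
    rw [mul_apply_eq_comp, mul_apply_eq_comp, this, ih]

lemma inner_adjoint_pow_adjoint_pow_of_le {F₀ F₁ : H →L[ℂ] H}
    (h00 : F₀ ∘L adjoint F₀ = 1) (h11 : F₁ ∘L adjoint F₁ = 1) (h10 : F₁ ∘L adjoint F₀ = 0)
    {j k : ℕ} (hjk : j ≤ k) (x y : H) :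
    ⟪(adjoint F₀ ^ j) (adjoint F₁ x), (adjoint F₀ ^ k) (adjoint F₁ y)⟫_ℂ =
      (if j = k then 1 else 0) * ⟪x, y⟫_ℂ := by
  obtain ⟨m, rfl⟩ := Nat.exists_eq_add_of_le hjk
  rw [inner_adjoint_pow_apply, pow_apply_adjoint_pow_add h00]
  cases m with
  | zero =>
    have := DFunLike.congr_fun h11 y
    simp only [comp_apply, one_apply_eq_self] at this
    simp [this]
  | succ m =>
    have := DFunLike.congr_fun h10 ((adjoint F₀ ^ m) (adjoint F₁ y))
    simp only [comp_apply, zero_apply] at this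
    rw [pow_succ', mul_apply_eq_comp, this]
    simp

lemma norm_sq_eq_sub_of_adjoint_comp_add {F₀ F₁ : H →L[ℂ] H}
    (hqmf : adjoint F₀ ∘L F₀ + adjoint F₁ ∘L F₁ = 1) (f : H) :
    ‖F₁ f‖ ^ 2 = ‖f‖ ^ 2 - ‖F₀ f‖ ^ 2 := by
  have h := congrArg (fun y => RCLike.re ⟪y, f⟫_ℂ) (DFunLike.congr_fun hqmf f)
  simp only [add_apply, comp_apply, one_apply_eq_self, inner_add_left, adjoint_inner_left, map_add,
    inner_self_eq_norm_sq] at h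
  linarith

lemma hasSum_norm_sq_wavelet_coefficients {F₀ F₁ : H →L[ℂ] H}
    (hqmf : adjoint F₀ ∘L F₀ + adjoint F₁ ∘L F₁ = 1) {f : H}
    (hpure : Filter.Tendsto (fun n : ℕ => (F₀ ^ n) f) Filter.atTop (nhds 0)) :
    HasSum (fun k : ℕ => ‖F₁ ((F₀ ^ k) f)‖ ^ 2) (‖f‖ ^ 2) := by
  rw [hasSum_iff_tendsto_nat_of_nonneg (fun _ => by positivity)]
  have hstep (k : ℕ) :
      ‖F₁ ((F₀ ^ k) f)‖ ^ 2 = ‖(F₀ ^ k) f‖ ^ 2 - ‖(F₀ ^ (k + 1)) f‖ ^ 2 := by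
    rw [norm_sq_eq_sub_of_adjoint_comp_add hqmf, pow_succ' F₀ k, mul_apply_eq_comp]
  simp only [hstep, Finset.sum_range_sub' (fun k => ‖(F₀ ^ k) f‖ ^ 2)]
  simpa using (hpure.norm.pow 2).const_sub (‖f‖ ^ 2)

end

/-- Let `F₀, F₁` be a discrete wavelet transform with perfect
reconstruction on a complex Hilbert space `H` (`F_i F_j* = δ_{ij}·I`,
`F₀*F₀ + F₁*F₁ = I`, and `F₀ⁿ f → 0` for all `f`), and let `(v s)_{s ∈ S}` be a frame for
`H` with bounds `0 < A₁ ≤ A₂`.  Set `v (k, s) := F₀*^k F₁* (v s)`.  Then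
(i) `⟨v (j, s), v (k, t)⟩ = δ_{jk} ⟨v s, v t⟩` (so the Gramian of the refined system is
`I ⊗ G`), and (ii) `(v (k, s))_{k ≥ 0, s ∈ S}` is a frame for `H` with the same bounds. -/
theorem refined_wavelet_frame_same_bounds
    (H : Type*) [NormedAddCommGroup H] [InnerProductSpace ℂ H] [CompleteSpace H]
    (F₀ F₁ : H →L[ℂ] H)
    (h00 : F₀ ∘L adjoint F₀ = 1)
    (h11 : F₁ ∘L adjoint F₁ = 1)
    (h01 : F₀ ∘L adjoint F₁ = 0)
    (h10 : F₁ ∘L adjoint F₀ = 0)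
    (hqmf : adjoint F₀ ∘L F₀ + adjoint F₁ ∘L F₁ = 1)
    (hpure : ∀ f : H, Filter.Tendsto (fun n : ℕ => (F₀ ^ n) f) Filter.atTop (nhds 0))
    (S : Type*) [Countable S]
    (v : S → H) (A₁ A₂ : ℝ) (hA₁ : 0 < A₁) (hA₁₂ : A₁ ≤ A₂)
    (hframe : ∀ f : H,
      A₁ * ‖f‖ ^ 2 ≤ ∑' s : S, ‖⟪v s, f⟫_ℂ‖ ^ 2 ∧
      ∑' s : S, ‖⟪v s, f⟫_ℂ‖ ^ 2 ≤ A₂ * ‖f‖ ^ 2) :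
    (∀ (j k : ℕ) (s t : S),
        ⟪(adjoint F₀ ^ j) (adjoint F₁ (v s)), (adjoint F₀ ^ k) (adjoint F₁ (v t))⟫_ℂ =
          (if j = k then 1 else 0) * ⟪v s, v t⟫_ℂ) ∧
    (∀ f : H,
      A₁ * ‖f‖ ^ 2 ≤
        ∑' p : ℕ × S, ‖⟪(adjoint F₀ ^ p.1) (adjoint F₁ (v p.2)), f⟫_ℂ‖ ^ 2 ∧
      ∑' p : ℕ × S, ‖⟪(adjoint F₀ ^ p.1) (adjoint F₁ (v p.2)), f⟫_ℂ‖ ^ 2 ≤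
        A₂ * ‖f‖ ^ 2) := by
  refine ⟨fun j k s t => ?_, fun f => ?_⟩
  · rcases le_total j k with hjk | hkj
    · exact inner_adjoint_pow_adjoint_pow_of_le h00 h11 h10 hjk _ _
    · rw [← inner_conj_symm, inner_adjoint_pow_adjoint_pow_of_le h00 h11 h10 hkj, map_mul,
        inner_conj_symm]
      simp [eq_comm, apply_ite (starRingEnd ℂ)]
  · simp only [inner_adjoint_pow_apply]
    have hsum := hasSum_norm_sq_wavelet_coefficients hqmf (hpure f)
    have hfib (k : ℕ) : Summable fun s : S => ‖⟪v s, F₁ ((F₀ ^ k) f)⟫_ℂ‖ ^ 2 :=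
      summable_of_frame_lower_bound hA₁ (hframe _).1
    have hout : Summable fun k : ℕ => ∑' s : S, ‖⟪v s, F₁ ((F₀ ^ k) f)⟫_ℂ‖ ^ 2 :=
      (hsum.summable.mul_left A₂).of_nonneg_of_le
        (fun _ => tsum_nonneg fun _ => by positivity) (fun _ => (hframe _).2)
    have hprod : Summable fun p : ℕ × S => ‖⟪v p.2, F₁ ((F₀ ^ p.1) f)⟫_ℂ‖ ^ 2 :=
      (summable_prod_of_nonneg fun _ => by positivity).mpr ⟨hfib, hout⟩
    rw [hprod.tsum_prod' hfib]
    exact ⟨hasSum_le (fun _ => (hframe _).1) (hsum.mul_left A₁) hout.hasSum,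
      hasSum_le (fun _ => (hframe _).2) hout.hasSum (hsum.mul_left A₂)⟩
end
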